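/- arXiv:0904.3210 — 2 statements merged into one kernel-verified Lean document; each statement's English description precedes it below -/
import Mathlib

section
/- The cash number operator and (c†)^P̂ satisfy the commutation rule [k̂, (c†)^P̂] = P̂ (c†)^P̂ = (c†)^P̂ P̂ as linear operators on V, where [A,B] = AB − BA. -/
/- Context: V is the free complex vector space on the basis {φ_{k,m} : k, m ∈ ℕ},
realized as finitely supported functions (ℕ × ℕ) →₀ ℂ. The first index is the
cash index k, the second is the price index m. -/

noncomputable section

abbrev V := (ℕ × ℕ) →₀ ℂ

/-- The annihilation operator c : φ_{k,m} ↦ √k φ_{k−1,m} (zero if k = 0). -/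
def cOp : Module.End ℂ V :=
  Finsupp.lift _ ℂ (ℕ × ℕ) fun i =>
    Finsupp.single (i.1 - 1, i.2) ((Real.sqrt i.1 : ℝ) : ℂ)

/-- The creation operator c† : φ_{k,m} ↦ √(k+1) φ_{k+1,m}. -/
def cdagOp : Module.End ℂ V :=
  Finsupp.lift _ ℂ (ℕ × ℕ) fun i =>
    Finsupp.single (i.1 + 1, i.2) ((Real.sqrt (i.1 + 1) : ℝ) : ℂ)

/-- The annihilation operator p : φ_{k,m} ↦ √m φ_{k,m−1} (zero if m = 0). -/
def pOp : Module.End ℂ V :=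
  Finsupp.lift _ ℂ (ℕ × ℕ) fun i =>
    Finsupp.single (i.1, i.2 - 1) ((Real.sqrt i.2 : ℝ) : ℂ)

/-- The creation operator p† : φ_{k,m} ↦ √(m+1) φ_{k,m+1}. -/
def pdagOp : Module.End ℂ V :=
  Finsupp.lift _ ℂ (ℕ × ℕ) fun i =>
    Finsupp.single (i.1, i.2 + 1) ((Real.sqrt (i.2 + 1) : ℝ) : ℂ)

/-- The cash number operator k̂ = c†c. -/
def khat : Module.End ℂ V := cdagOp * cOp

/-- The price number operator P̂ = p†p. -/
def Phat : Module.End ℂ V := pdagOp * pOp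

/-- The operator c^P̂ : φ_{k,m} ↦ φ_{k,m} if m = 0; 0 if m > k;
√(k(k−1)⋯(k−m+1)) φ_{k−m,m} if 0 < m ≤ k. -/
def cPowP : Module.End ℂ V :=
  Finsupp.lift _ ℂ (ℕ × ℕ) fun i =>
    if i.2 ≤ i.1 then
      Finsupp.single (i.1 - i.2, i.2)
        ((Real.sqrt (∏ j ∈ Finset.range i.2, ((i.1 : ℝ) - j)) : ℝ) : ℂ)
    else 0

/-- The operator (c†)^P̂ : φ_{k,m} ↦ φ_{k,m} if m = 0;
√((k+1)(k+2)⋯(k+m)) φ_{k+m,m} if m > 0. -/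
def cdagPowP : Module.End ℂ V :=
  Finsupp.lift _ ℂ (ℕ × ℕ) fun i =>
    Finsupp.single (i.1 + i.2, i.2)
      ((Real.sqrt (∏ j ∈ Finset.range i.2, ((i.1 : ℝ) + j + 1)) : ℝ) : ℂ)

/-- The opComm [A,B] = AB − BA. -/
def opComm (A B : Module.End ℂ V) : Module.End ℂ V := A * B - B * A

theorem cOp_single (k m : ℕ) (a : ℂ) :
    cOp (Finsupp.single (k, m) a) =
      Finsupp.single (k - 1, m) (a * (Real.sqrt k : ℝ)) := by
  simp [cOp]

theorem cdagOp_single (k m : ℕ) (a : ℂ) :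
    cdagOp (Finsupp.single (k, m) a) =
      Finsupp.single (k + 1, m) (a * (Real.sqrt (k + 1) : ℝ)) := by
  simp [cdagOp]

theorem pOp_single (k m : ℕ) (a : ℂ) :
    pOp (Finsupp.single (k, m) a) =
      Finsupp.single (k, m - 1) (a * (Real.sqrt m : ℝ)) := by
  simp [pOp]

theorem pdagOp_single (k m : ℕ) (a : ℂ) :
    pdagOp (Finsupp.single (k, m) a) =
      Finsupp.single (k, m + 1) (a * (Real.sqrt (m + 1) : ℝ)) := by
  simp [pdagOp]

theorem khat_single (k m : ℕ) (a : ℂ) :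
    khat (Finsupp.single (k, m) a) = Finsupp.single (k, m) (a * k) := by
  cases k with
  | zero => simp [khat, cdagOp, cOp]
  | succ k =>
    have h : ((Real.sqrt ((k : ℝ) + 1) : ℝ) : ℂ) * (Real.sqrt ((k : ℝ) + 1) : ℝ) = k + 1 := by
      rw [← Complex.ofReal_mul, Real.mul_self_sqrt (by positivity)]
      push_cast
      rfl
    rw [khat, Module.End.mul_apply, cOp_single, cdagOp_single, Nat.add_sub_cancel, mul_assoc,
      Nat.cast_succ, h, Nat.cast_succ]

theorem Phat_single (k m : ℕ) (a : ℂ) :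
    Phat (Finsupp.single (k, m) a) = Finsupp.single (k, m) (a * m) := by
  cases m with
  | zero => simp [Phat, pdagOp, pOp]
  | succ m =>
    have h : ((Real.sqrt ((m : ℝ) + 1) : ℝ) : ℂ) * (Real.sqrt ((m : ℝ) + 1) : ℝ) = m + 1 := by
      rw [← Complex.ofReal_mul, Real.mul_self_sqrt (by positivity)]
      push_cast
      rfl
    rw [Phat, Module.End.mul_apply, pOp_single, pdagOp_single, Nat.add_sub_cancel, mul_assoc,
      Nat.cast_succ, h, Nat.cast_succ]

theorem cdagPowP_single (k m : ℕ) (a : ℂ) :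
    cdagPowP (Finsupp.single (k, m) a) =
      Finsupp.single (k + m, m)
        (a * (Real.sqrt (∏ j ∈ Finset.range m, ((k : ℝ) + j + 1)) : ℝ)) := by
  simp [cdagPowP]

theorem Phat_mul_cdagPowP : Phat * cdagPowP = cdagPowP * Phat := by
  refine Finsupp.lhom_ext fun ⟨k, m⟩ a => ?_
  simp only [Module.End.mul_apply, Phat_single, cdagPowP_single, mul_right_comm]

/-- [k̂, (c†)^P̂] = P̂ (c†)^P̂ = (c†)^P̂ P̂. -/
theorem khat_comm_cdagPowP :
    opComm khat cdagPowP = Phat * cdagPowP ∧ opComm khat cdagPowP = cdagPowP * Phat := by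
  have h : opComm khat cdagPowP = Phat * cdagPowP := by
    refine Finsupp.lhom_ext fun ⟨k, m⟩ a => ?_
    simp only [opComm, LinearMap.sub_apply, Module.End.mul_apply, khat_single, Phat_single,
      cdagPowP_single, ← Finsupp.single_sub]
    congr 1
    push_cast
    ring
  exact ⟨h, h.trans Phat_mul_cdagPowP⟩

end
end

section
/- The mean-field share-number function n(t) satisfies the initial conditions n(0) = n₀ and n'(0) = 0, and solves the second-order ODE n''(t) + ω²·n(t) = n₀·(Φ−ν)² + 8R·(n₀ + k₀) for all real t; in particular n(t) oscillates harmonically with frequency ω = √((Φ−ν)² + 16R). -/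
theorem hasDerivAt_const_add_mul_cos (a b ω t : ℝ) :
    HasDerivAt (fun t => a + b * Real.cos (ω * t)) (-(b * ω) * Real.sin (ω * t)) t := by
  have h := (((hasDerivAt_id' t).const_mul ω).cos.const_mul b).const_add a
  exact h.congr_deriv (by ring)

theorem hasDerivAt_const_mul_sin (c ω t : ℝ) :
    HasDerivAt (fun t => c * Real.sin (ω * t)) (c * ω * Real.cos (ω * t)) t := by
  have h := ((hasDerivAt_id' t).const_mul ω).sin.const_mul c
  exact h.congr_deriv (by ring)


/-- with ω = √((Φ−ν)² + 16R) and
n(t) = (1/ω²){ n₀(Φ−ν)² − 8R( k₀(cos ωt − 1) − n₀(cos ωt + 1) ) },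
the mean-field share-number function n satisfies n(0) = n₀, n'(0) = 0, and
n''(t) + ω²n(t) = n₀(Φ−ν)² + 8R(n₀ + k₀) for all t, i.e. n oscillates
harmonically with frequency ω. -/
theorem mean_field_share_number_ode
    (Φ ν n₀ k₀ R : ℝ) (hR : 0 ≤ R) (hpos : (Φ - ν) ^ 2 + 16 * R > 0)
    (ω : ℝ) (hω : ω = Real.sqrt ((Φ - ν) ^ 2 + 16 * R))
    (n : ℝ → ℝ)
    (hn : ∀ t : ℝ, n t = (1 / ω ^ 2) *
      (n₀ * (Φ - ν) ^ 2
        - 8 * R * (k₀ * (Real.cos (ω * t) - 1) - n₀ * (Real.cos (ω * t) + 1)))) :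
    n 0 = n₀ ∧ deriv n 0 = 0 ∧
    ∀ t : ℝ, deriv (deriv n) t + ω ^ 2 * n t
      = n₀ * (Φ - ν) ^ 2 + 8 * R * (n₀ + k₀) := by
  have hsq : ω ^ 2 = (Φ - ν) ^ 2 + 16 * R := by rw [hω, Real.sq_sqrt hpos.le]
  have hne : ω ^ 2 ≠ 0 := hsq ▸ hpos.ne'
  have hn' : n = fun t => (n₀ * (Φ - ν) ^ 2 + 8 * R * (n₀ + k₀)) / ω ^ 2
      + 8 * R * (n₀ - k₀) / ω ^ 2 * Real.cos (ω * t) := by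
    funext t
    rw [hn t]
    ring
  have hd : deriv n = fun t => -(8 * R * (n₀ - k₀) / ω ^ 2 * ω) * Real.sin (ω * t) := by
    funext t
    rw [hn']
    exact (hasDerivAt_const_add_mul_cos _ _ ω t).deriv
  refine ⟨?_, by simp [hd], fun t => ?_⟩
  · rw [hn 0, mul_zero, Real.cos_zero, one_div, inv_mul_eq_iff_eq_mul₀ hne, hsq]
    ring
  · rw [hd, (hasDerivAt_const_mul_sin _ ω t).deriv, hn']
    linear_combination mul_div_cancel₀ (n₀ * (Φ - ν) ^ 2 + 8 * R * (n₀ + k₀)) hne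
end
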